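/- Let k ≥ 3 and t ≥ 2 be integers, let λ be the second largest eigenvalue of T(k,t,1), and suppose there exists a connected k-regular finite simple graph on M(k,t,1) vertices with second largest adjacency eigenvalue at most λ. Let c₁ > k(k−1)^{t−1} be real and let λ₁ be the second largest eigenvalue of T(k,t+1,c₁). Then the maximum number of vertices of a connected k-regular graph with second largest adjacency eigenvalue at most λ₁ equals M(k,t,1), i.e., every connected k-regular graph G with λ₂(G) ≤ λ₁ has at most M(k,t,1) vertices. Moreover, if M(k,t,1) is even and k is odd, the same conclusion already holds for every c₁ > k(k−1)^{t−1}/2. -/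

import Mathlib

open Polynomial

/-- The adjacency matrix of a simple graph over `ℝ` is Hermitian. -/
theorem adjMatrix_isHermitian {V : Type*} [Fintype V] [DecidableEq V]
    (G : SimpleGraph V) [DecidableRel G.Adj] : (G.adjMatrix ℝ).IsHermitian := by
  rw [Matrix.IsHermitian, Matrix.conjTranspose_eq_transpose_of_trivial]
  exact G.isSymm_adjMatrix

/-- The multiset of adjacency eigenvalues (with multiplicity) of a finite simple graph. -/
noncomputable def eigMultiset {V : Type*} [Fintype V] [DecidableEq V]
    (G : SimpleGraph V) [DecidableRel G.Adj] : Multiset ℝ :=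
  Multiset.map (adjMatrix_isHermitian G).eigenvalues Finset.univ.val

/-- The second largest adjacency eigenvalue (with multiplicity) of a finite simple graph:
the second-to-last entry of the nondecreasing sorted list of eigenvalues. -/
noncomputable def secondEigenvalue {V : Type*} [Fintype V] [DecidableEq V]
    (G : SimpleGraph V) [DecidableRel G.Adj] : ℝ :=
  ((eigMultiset G).sort (· ≤ ·)).getD (((eigMultiset G).sort (· ≤ ·)).length - 2) 0

/-- The largest adjacency eigenvalue (spectral radius) of a finite simple graph. -/
noncomputable def largestEigenvalue {V : Type*} [Fintype V] [DecidableEq V]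
    (G : SimpleGraph V) [DecidableRel G.Adj] : ℝ :=
  ((eigMultiset G).sort (· ≤ ·)).getD (((eigMultiset G).sort (· ≤ ·)).length - 1) 0

/-- The orthogonal polynomials `F_i^{(k)}`. -/
noncomputable def Fpoly (k : ℕ) : ℕ → Polynomial ℝ
  | 0 => 1
  | 1 => X
  | 2 => X ^ 2 - C (k : ℝ)
  | n + 3 => X * Fpoly k (n + 2) - C ((k : ℝ) - 1) * Fpoly k (n + 1)

/-- `G_i = Σ_{j=0}^i F_j`. -/
noncomputable def Gpoly (k : ℕ) (i : ℕ) : Polynomial ℝ :=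
  ∑ j ∈ Finset.range (i + 1), Fpoly k j

/-- The tridiagonal matrix `T(k,t,c)`: superdiagonal `(k, k-1, …, k-1)`,
subdiagonal `(1, …, 1, c)`, diagonal chosen so that every row sums to `k`. -/
noncomputable def Tmat (k t : ℕ) (c : ℝ) : Matrix (Fin t) (Fin t) ℝ :=
  Matrix.of fun i j =>
    if (j : ℕ) = (i : ℕ) + 1 then (if (i : ℕ) = 0 then (k : ℝ) else (k : ℝ) - 1)
    else if (i : ℕ) = (j : ℕ) + 1 then (if (i : ℕ) = t - 1 then c else 1)
    else if i = j then
      (k : ℝ) - (if (i : ℕ) + 1 < t then (if (i : ℕ) = 0 then (k : ℝ) else (k : ℝ) - 1) else 0)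
        - (if 0 < (i : ℕ) then (if (i : ℕ) = t - 1 then c else 1) else 0)
    else 0

/-- `M(k,t,c) = 1 + Σ_{i=0}^{t-3} k (k-1)^i + k (k-1)^{t-2} / c`. -/
noncomputable def Mbound (k t : ℕ) (c : ℝ) : ℝ :=
  1 + (∑ i ∈ Finset.range (t - 2), (k : ℝ) * ((k : ℝ) - 1) ^ i)
    + (k : ℝ) * ((k : ℝ) - 1) ^ (t - 2) / c

theorem Gpoly_zero_eval (k : ℕ) (x : ℝ) : (Gpoly k 0).eval x = 1 := by
  simp [Gpoly, Fpoly]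

theorem Gpoly_one_eval (k : ℕ) (x : ℝ) : (Gpoly k 1).eval x = x + 1 := by
  simp [Gpoly, Finset.sum_range_succ, Fpoly, add_comm]

theorem Gpoly_succ (k n : ℕ) : Gpoly k (n + 1) = Gpoly k n + Fpoly k (n + 1) := by
  simp [Gpoly, Finset.sum_range_succ]

theorem Gpoly_eval_add_two (k n : ℕ) (x : ℝ) :
    (Gpoly k (n + 2)).eval x
      = x * (Gpoly k (n + 1)).eval x - ((k : ℝ) - 1) * (Gpoly k n).eval x := by
  induction n with
  | zero =>
    simp [Gpoly, Finset.sum_range_succ, Fpoly]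
    ring
  | succ n ih =>
    have h₁ := congrArg (eval x) (Gpoly_succ k n)
    have h₂ := congrArg (eval x) (Gpoly_succ k (n + 1))
    rw [Gpoly_succ, eval_add]
    rw [eval_add] at h₁ h₂
    simp only [Fpoly, eval_sub, eval_mul, eval_X, eval_C] at h₂ ⊢
    linear_combination ih - x * h₂ + ((k : ℝ) - 1) * h₁

/-- The Christoffel–Darboux identity for the polynomials `G_i`. -/
theorem Gpoly_christoffel_darboux (k n : ℕ) (x y : ℝ) :
    (Gpoly k (n + 1)).eval x * (Gpoly k n).eval y - (Gpoly k n).eval x * (Gpoly k (n + 1)).eval y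
      = (x - y) * ∑ i ∈ Finset.range (n + 1),
          ((k : ℝ) - 1) ^ (n - i) * (Gpoly k i).eval y * (Gpoly k i).eval x := by
  induction n with
  | zero =>
    simp [Gpoly_zero_eval, Gpoly_one_eval]
  | succ n ih =>
    have hsum : ∑ i ∈ Finset.range (n + 1),
          ((k : ℝ) - 1) ^ (n + 1 - i) * (Gpoly k i).eval y * (Gpoly k i).eval x
        = ((k : ℝ) - 1) * ∑ i ∈ Finset.range (n + 1),
          ((k : ℝ) - 1) ^ (n - i) * (Gpoly k i).eval y * (Gpoly k i).eval x := by
      rw [Finset.mul_sum]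
      refine Finset.sum_congr rfl fun i hi => ?_
      rw [Nat.succ_sub (Nat.lt_succ_iff.mp (Finset.mem_range.mp hi)), pow_succ]
      ring
    rw [Finset.sum_range_succ, hsum, mul_add, mul_left_comm, ← ih, Gpoly_eval_add_two,
      Gpoly_eval_add_two]
    simp
    ring

/-- The value of `F_i` at `k`. -/
theorem Fpoly_eval_natCast (k n : ℕ) :
    (Fpoly k (n + 1)).eval (k : ℝ) = k * ((k : ℝ) - 1) ^ n := by
  induction n using Nat.twoStepInduction with
  | zero => simp [Fpoly]
  | one => simp [Fpoly]; ring
  | more n h₁ h₂ =>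
    simp only [Fpoly, eval_sub, eval_mul, eval_X, eval_C, h₁, h₂]
    ring

theorem Fpoly_eval_pos_and_growth {k : ℕ} (hk : 2 ≤ k) {x : ℝ} (hx : (k : ℝ) ≤ x) (n : ℕ) :
    0 < (Fpoly k (n + 1)).eval x ∧
      ((k : ℝ) - 1) * (Fpoly k (n + 1)).eval x ≤ (Fpoly k (n + 2)).eval x := by
  have hk' : (2 : ℝ) ≤ k := by exact_mod_cast hk
  induction n with
  | zero =>
    simp [Fpoly]
    constructor <;> nlinarith
  | succ n ih =>
    have hpos : 0 < (Fpoly k (n + 2)).eval x := by nlinarith [ih.1, ih.2]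
    refine ⟨hpos, ?_⟩
    simp only [Fpoly, eval_sub, eval_mul, eval_X, eval_C]
    nlinarith [ih.1, ih.2]

theorem Fpoly_eval_pos {k : ℕ} (hk : 2 ≤ k) {x : ℝ} (hx : (k : ℝ) ≤ x) (n : ℕ) :
    0 < (Fpoly k n).eval x := by
  cases n with
  | zero => simp [Fpoly]
  | succ n => exact (Fpoly_eval_pos_and_growth hk hx n).1

theorem Gpoly_eval_pos {k : ℕ} (hk : 2 ≤ k) {x : ℝ} (hx : (k : ℝ) ≤ x) (n : ℕ) :
    0 < (Gpoly k n).eval x := by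
  rw [Gpoly, eval_finsetSum]
  exact Finset.sum_pos (fun i _ => Fpoly_eval_pos hk hx i) (by simp)

/-- A polynomial negative at `a` and positive on `[K, ∞)` has a largest root, lying beyond `a`,
after which it is positive. -/
theorem exists_root_gt_of_eval_neg {p : ℝ[X]} {a K : ℝ} (ha : p.eval a < 0)
    (hK : ∀ x, K ≤ x → 0 < p.eval x) :
    ∃ r, a < r ∧ p.IsRoot r ∧ ∀ x, r < x → 0 < p.eval x := by
  have hp : p ≠ 0 := by rintro rfl; simp at ha
  have ivt : ∀ x, p.eval x < 0 → ∃ y, x < y ∧ p.IsRoot y := by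
    intro x hx
    have hle : x ≤ max x K := le_max_left _ _
    obtain ⟨y, hy, hy0⟩ := intermediate_value_Icc hle p.continuous.continuousOn
      ⟨hx.le, (hK _ (le_max_right x K)).le⟩
    refine ⟨y, lt_of_le_of_ne hy.1 ?_, hy0⟩
    rintro rfl
    exact hx.ne hy0
  obtain ⟨y, hay, hy⟩ := ivt a ha
  obtain ⟨r, hr, hmax⟩ := p.roots.toFinset.exists_max_image id ⟨y, by simpa [hp] using hy⟩
  simp only [Multiset.mem_toFinset, mem_roots hp, id] at hr hmax
  refine ⟨r, hay.trans_le (hmax y hy), hr, fun x hx => ?_⟩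
  rcases lt_trichotomy (p.eval x) 0 with h | h | h
  · obtain ⟨z, hz, hz0⟩ := ivt x h
    exact absurd (hmax z hz0) (by linarith)
  · exact absurd (hmax x h) (by linarith)
  · exact h

/-- Interlacing: the largest root of `G_n` is beyond all roots of the earlier `G_j`. -/
theorem Gpoly_exists_largest_root {k : ℕ} (hk : 2 ≤ k) (n : ℕ) :
    ∃ r : ℝ, (Gpoly k (n + 1)).IsRoot r ∧ (∀ x, r < x → 0 < (Gpoly k (n + 1)).eval x) ∧
      ∀ x, r ≤ x → ∀ j ≤ n, 0 < (Gpoly k j).eval x := by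
  have hk' : (2 : ℝ) ≤ k := by exact_mod_cast hk
  induction n with
  | zero =>
    refine ⟨-1, by simp [IsRoot, Gpoly_one_eval], fun x hx => ?_, fun x _ j hj => ?_⟩
    · rw [Gpoly_one_eval]; linarith
    · rw [Nat.le_zero.mp hj, Gpoly_zero_eval]; exact one_pos
  | succ n ih =>
    obtain ⟨r, hr, hpos, hlow⟩ := ih
    have hneg : (Gpoly k (n + 2)).eval r < 0 := by
      rw [Gpoly_eval_add_two, hr.eq_zero]
      have := hlow r le_rfl n le_rfl
      nlinarith
    obtain ⟨s, hrs, hs, hspos⟩ :=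
      exists_root_gt_of_eval_neg hneg fun x hx => Gpoly_eval_pos hk hx (n + 2)
    refine ⟨s, hs, hspos, fun x hx j hj => ?_⟩
    rcases Nat.le_succ_iff.mp hj with h | rfl
    · exact hlow x (by linarith) j h
    · exact hpos x (by linarith)

/-- All `G_j`, `j ≤ n + 1`, are positive at the largest root of `(c - 1) G_{n+1} + G_{n+2}`. -/
theorem Gpoly_eval_pos_of_largest_root {k : ℕ} (hk : 2 ≤ k) (n : ℕ) {c l : ℝ} (hc : 1 ≤ c)
    (hmax : ∀ x : ℝ, (C (c - 1) * Gpoly k (n + 1) + Gpoly k (n + 2)).IsRoot x → x ≤ l)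
    {j : ℕ} (hj : j ≤ n + 1) : 0 < (Gpoly k j).eval l := by
  have hk' : (2 : ℝ) ≤ k := by exact_mod_cast hk
  obtain ⟨r, hr, hpos, hlow⟩ := Gpoly_exists_largest_root hk n
  have hneg : (C (c - 1) * Gpoly k (n + 1) + Gpoly k (n + 2)).eval r < 0 := by
    rw [eval_add, eval_mul, Gpoly_eval_add_two, hr.eq_zero]
    have := hlow r le_rfl n le_rfl
    nlinarith
  obtain ⟨s, hrs, hs, -⟩ := exists_root_gt_of_eval_neg (K := (k : ℝ)) hneg fun x hx => by
    rw [eval_add, eval_mul, eval_C]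
    have h₁ := Gpoly_eval_pos hk hx (n + 1)
    have h₂ := Gpoly_eval_pos hk hx (n + 2)
    have := mul_nonneg (sub_nonneg.mpr hc) h₁.le
    linarith
  have hrl : r < l := hrs.trans_le (hmax s hs)
  rcases Nat.le_succ_iff.mp hj with h | rfl
  · exact hlow l hrl.le j h
  · exact hpos l hrl

section Graph

variable {V : Type*} [Fintype V] [DecidableEq V] (G : SimpleGraph V) [DecidableRel G.Adj]

/-- The number of non-backtracking walks in `G` that start at `u`, have `n + 1` steps, and whose
last step goes from `a` to `b`. -/
def nonBacktrackingCount (u : V) : ℕ → V → V → ℕ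
  | 0, a, b => if u = a ∧ G.Adj a b then 1 else 0
  | n + 1, a, b =>
    if G.Adj a b then ∑ x ∈ Finset.univ.erase b, nonBacktrackingCount u n x a else 0

variable {G}

theorem nonBacktrackingCount_of_not_adj {u a b : V} (h : ¬ G.Adj a b) (n : ℕ) :
    nonBacktrackingCount G u n a b = 0 := by
  cases n <;> simp [nonBacktrackingCount, h]

theorem nonBacktrackingCount_succ_of_adj {u a b : V} (h : G.Adj a b) (n : ℕ) :
    (nonBacktrackingCount G u (n + 1) a b : ℝ)
      = (∑ x, (nonBacktrackingCount G u n x a : ℝ)) - nonBacktrackingCount G u n b a := by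
  rw [nonBacktrackingCount, if_pos h, Nat.cast_sum, ← Finset.sum_erase_add _ _ (Finset.mem_univ b)]
  ring

theorem sum_nonBacktrackingCount_eq_sum_neighborFinset (u v : V) (n : ℕ) :
    (∑ x, (nonBacktrackingCount G u n x v : ℝ))
      = ∑ x ∈ G.neighborFinset v, (nonBacktrackingCount G u n x v : ℝ) := by
  refine (Finset.sum_subset (Finset.subset_univ _) fun x _ hx => ?_).symm
  rw [nonBacktrackingCount_of_not_adj (by simpa [G.adj_comm] using hx), Nat.cast_zero]

theorem sum_nonBacktrackingCount_zero (u v : V) :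
    (∑ x, (nonBacktrackingCount G u 0 x v : ℝ)) = G.adjMatrix ℝ u v := by
  simp [nonBacktrackingCount, SimpleGraph.adjMatrix_apply, ite_and]

theorem sum_nonBacktrackingCount_succ (u v : V) (n : ℕ) :
    (∑ x, (nonBacktrackingCount G u (n + 1) x v : ℝ))
      = (∑ a ∈ G.neighborFinset v, ∑ x, (nonBacktrackingCount G u n x a : ℝ))
        - ∑ a ∈ G.neighborFinset v, (nonBacktrackingCount G u n v a : ℝ) := by
  rw [sum_nonBacktrackingCount_eq_sum_neighborFinset, ← Finset.sum_sub_distrib]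
  refine Finset.sum_congr rfl fun a ha => ?_
  rw [nonBacktrackingCount_succ_of_adj (by simpa [G.adj_comm] using ha)]

theorem sum_nonBacktrackingCount_neighborFinset_zero {k : ℕ} (hG : G.IsRegularOfDegree k)
    (u v : V) :
    (∑ a ∈ G.neighborFinset v, (nonBacktrackingCount G u 0 v a : ℝ))
      = if u = v then (k : ℝ) else 0 := by
  have h : ∀ a ∈ G.neighborFinset v,
      (nonBacktrackingCount G u 0 v a : ℝ) = if u = v then 1 else 0 := by
    intro a ha
    simp [nonBacktrackingCount, (G.mem_neighborFinset v a).mp ha]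
  rw [Finset.sum_congr rfl h, Finset.sum_const, SimpleGraph.card_neighborFinset_eq_degree, hG v]
  simp

theorem sum_nonBacktrackingCount_neighborFinset_succ {k : ℕ} (hG : G.IsRegularOfDegree k)
    (u v : V) (n : ℕ) :
    (∑ a ∈ G.neighborFinset v, (nonBacktrackingCount G u (n + 1) v a : ℝ))
      = ((k : ℝ) - 1) * ∑ x, (nonBacktrackingCount G u n x v : ℝ) := by
  rw [Finset.sum_congr rfl fun a ha =>
    nonBacktrackingCount_succ_of_adj ((G.mem_neighborFinset v a).mp ha) n,
    Finset.sum_sub_distrib, ← sum_nonBacktrackingCount_eq_sum_neighborFinset, Finset.sum_const,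
    SimpleGraph.card_neighborFinset_eq_degree, hG v, nsmul_eq_mul]
  ring

/-- For a `k`-regular graph, the entries of `F_{n+1}(A)` count non-backtracking walks. -/
theorem aeval_Fpoly_succ_apply {k : ℕ} (hG : G.IsRegularOfDegree k) (n : ℕ) (u v : V) :
    aeval (G.adjMatrix ℝ) (Fpoly k (n + 1)) u v = ∑ x, (nonBacktrackingCount G u n x v : ℝ) := by
  induction n using Nat.twoStepInduction generalizing v with
  | zero => simp only [Fpoly, aeval_X, sum_nonBacktrackingCount_zero]
  | one =>
    rw [sum_nonBacktrackingCount_succ, sum_nonBacktrackingCount_neighborFinset_zero hG]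
    simp only [sum_nonBacktrackingCount_zero, Fpoly, map_sub, aeval_C,
      Matrix.sub_apply, pow_two, Matrix.algebraMap_matrix_apply]
    simp
  | more n h₁ h₂ =>
    rw [sum_nonBacktrackingCount_succ, sum_nonBacktrackingCount_neighborFinset_succ hG, ← h₁]
    simp only [← h₂]
    have hcomm : X * Fpoly k (n + 2) = Fpoly k (n + 2) * X := mul_comm _ _
    rw [Fpoly, hcomm, map_sub, Matrix.sub_apply, map_mul, aeval_X, SimpleGraph.mul_adjMatrix_apply,
      map_mul, aeval_C, ← Algebra.smul_def, Matrix.smul_apply, smul_eq_mul]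

theorem exists_natCast_aeval_Fpoly {k : ℕ} (hG : G.IsRegularOfDegree k) (n : ℕ) (u v : V) :
    ∃ m : ℕ, aeval (G.adjMatrix ℝ) (Fpoly k n) u v = m := by
  cases n with
  | zero =>
    refine ⟨if u = v then 1 else 0, ?_⟩
    simp [Fpoly, Matrix.one_apply]
  | succ n => exact ⟨∑ x, nonBacktrackingCount G u n x v, by
      rw [aeval_Fpoly_succ_apply hG, Nat.cast_sum]⟩

theorem aeval_Fpoly_nonneg {k : ℕ} (hG : G.IsRegularOfDegree k) (n : ℕ) (u v : V) :
    0 ≤ aeval (G.adjMatrix ℝ) (Fpoly k n) u v := by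
  obtain ⟨m, hm⟩ := exists_natCast_aeval_Fpoly hG n u v
  exact hm ▸ m.cast_nonneg

theorem aeval_Gpoly_apply (k n : ℕ) (u v : V) :
    aeval (G.adjMatrix ℝ) (Gpoly k n) u v
      = ∑ j ∈ Finset.range (n + 1), aeval (G.adjMatrix ℝ) (Fpoly k j) u v := by
  rw [Gpoly, map_sum, Matrix.sum_apply]

theorem aeval_Gpoly_nonneg {k : ℕ} (hG : G.IsRegularOfDegree k) (n : ℕ) (u v : V) :
    0 ≤ aeval (G.adjMatrix ℝ) (Gpoly k n) u v := by
  rw [aeval_Gpoly_apply]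
  exact Finset.sum_nonneg fun j _ => aeval_Fpoly_nonneg hG j u v

theorem aeval_Gpoly_mono {k : ℕ} (hG : G.IsRegularOfDegree k) (u v : V) :
    Monotone fun n => aeval (G.adjMatrix ℝ) (Gpoly k n) u v := by
  refine monotone_nat_of_le_succ fun n => ?_
  rw [Gpoly_succ, map_add, Matrix.add_apply]
  exact le_add_of_nonneg_right (aeval_Fpoly_nonneg hG _ u v)

theorem aeval_Gpoly_eq_zero_or_one_le {k : ℕ} (hG : G.IsRegularOfDegree k) (n : ℕ) (u v : V) :
    aeval (G.adjMatrix ℝ) (Gpoly k n) u v = 0 ∨ 1 ≤ aeval (G.adjMatrix ℝ) (Gpoly k n) u v := by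
  choose m hm using fun j => exists_natCast_aeval_Fpoly hG j u v
  rw [aeval_Gpoly_apply, Finset.sum_congr rfl fun j _ => hm j, ← Nat.cast_sum]
  rcases Nat.eq_zero_or_pos (∑ j ∈ Finset.range (n + 1), m j) with h | h
  · left; exact_mod_cast h
  · right; exact_mod_cast h

theorem aeval_adjMatrix_mulVec_one {k : ℕ} (hG : G.IsRegularOfDegree k) (p : ℝ[X]) :
    (aeval (G.adjMatrix ℝ) p).mulVec 1 = fun _ => p.eval (k : ℝ) := by
  induction p using Polynomial.induction_on' with
  | add p q hp hq =>
    rw [map_add, Matrix.add_mulVec, hp, hq]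
    ext; simp
  | monomial n a =>
    have hpow : ((G.adjMatrix ℝ) ^ n).mulVec 1 = fun _ => (k : ℝ) ^ n := by
      induction n with
      | zero => ext; simp
      | succ n ih =>
        rw [pow_succ', ← Matrix.mulVec_mulVec, ih]
        ext v
        have := SimpleGraph.adjMatrix_mulVec_const_apply_of_regular (α := ℝ) (a := (k : ℝ) ^ n) hG
          (v := v)
        rw [pow_succ']
        exact this
    rw [aeval_monomial, ← Algebra.smul_def, Matrix.smul_mulVec, hpow]
    ext; simp

theorem sum_aeval_adjMatrix {k : ℕ} (hG : G.IsRegularOfDegree k) (p : ℝ[X]) (u : V) :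
    ∑ v, aeval (G.adjMatrix ℝ) p u v = p.eval (k : ℝ) := by
  have := congrFun (aeval_adjMatrix_mulVec_one hG p) u
  simpa [Matrix.mulVec, dotProduct] using this

theorem isSymm_aeval {A : Matrix V V ℝ} (hA : A.IsSymm) (p : ℝ[X]) : (aeval A p).IsSymm := by
  induction p using Polynomial.induction_on' with
  | add p q hp hq => rw [map_add]; exact hp.add hq
  | monomial n a => rw [aeval_monomial, ← Algebra.smul_def]; exact (hA.pow n).smul a

theorem trace_aeval_eq_sum_eigenvalues {A : Matrix V V ℝ} (hA : A.IsHermitian) (p : ℝ[X]) :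
    (aeval A p).trace = ∑ i, p.eval (hA.eigenvalues i) := by
  have hdiag : aeval (Matrix.diagonal hA.eigenvalues) p
      = Matrix.diagonal fun i => p.eval (hA.eigenvalues i) := by
    have := aeval_algHom_apply (Matrix.diagonalAlgHom (n := V) (α := ℝ) ℝ) hA.eigenvalues p
    rw [Matrix.diagonalAlgHom_apply] at this
    rw [this, Matrix.diagonalAlgHom_apply]
    congr 1
    ext i
    rw [aeval_pi_apply]
    simp
  have hspec : aeval A p = Unitary.conjStarAlgAut ℝ _ hA.eigenvectorUnitary
      (aeval (Matrix.diagonal hA.eigenvalues) p) := by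
    conv_lhs => rw [hA.spectral_theorem]
    exact aeval_algHom_apply
      (Unitary.conjStarAlgAut ℝ (Matrix V V ℝ) hA.eigenvectorUnitary).toAlgEquiv.toAlgHom _ p
  rw [hspec, hdiag, Unitary.conjStarAlgAut_apply, Matrix.trace_mul_comm, ← mul_assoc]
  simp [Matrix.trace]

theorem countP_lt_le_one_of_pairwise_le {L : List ℝ} (hL : L.Pairwise (· ≤ ·)) (hlen : 2 ≤ L.length)
    {l d : ℝ} (h : L.getD (L.length - 2) d ≤ l) : L.countP (l < ·) ≤ 1 := by
  rw [← List.take_append_drop (L.length - 1) L, List.countP_append]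
  have h₁ : (L.take (L.length - 1)).countP (l < ·) = 0 := by
    rw [List.countP_eq_zero]
    intro x hx
    obtain ⟨i, hi, rfl⟩ := List.mem_take_iff_getElem.mp hx
    have hi' : i < L.length - 1 := by omega
    rw [List.getD_eq_getElem _ _ (by omega : L.length - 2 < L.length)] at h
    simp only [decide_eq_true_eq, not_lt]
    refine le_trans ?_ h
    rcases Nat.lt_or_ge i (L.length - 2) with hlt | hge
    · exact List.pairwise_iff_getElem.mp hL _ _ _ _ hlt
    · exact le_of_eq (by congr 1; omega)
  have h₂ : (L.drop (L.length - 1)).countP (l < ·) ≤ 1 := by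
    refine List.countP_le_length.trans ?_
    rw [List.length_drop]
    omega
  omega

theorem eigenvalues_gt_subsingleton {l : ℝ} (hcard : 2 ≤ Fintype.card V)
    (h : secondEigenvalue G ≤ l) {i j : V} (hi : l < (adjMatrix_isHermitian G).eigenvalues i)
    (hj : l < (adjMatrix_isHermitian G).eigenvalues j) : i = j := by
  have hlen : 2 ≤ ((eigMultiset G).sort (· ≤ ·)).length := by
    rw [Multiset.length_sort]
    simpa [eigMultiset] using hcard
  have hcount := countP_lt_le_one_of_pairwise_le (Multiset.pairwise_sort _ _) hlen h
  rw [← Multiset.coe_countP, Multiset.sort_eq, eigMultiset, Multiset.countP_map] at hcount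
  have hcard' : (Finset.univ.filter
      fun i => l < (adjMatrix_isHermitian G).eigenvalues i).card ≤ 1 := hcount
  exact Finset.card_le_one.mp hcard' i (by simpa using hi) j (by simpa using hj)

theorem exists_eigenvalues_eq_degree [Nonempty V] {k : ℕ} (hG : G.IsRegularOfDegree k) :
    ∃ i, (adjMatrix_isHermitian G).eigenvalues i = k := by
  have hvec : Module.End.HasEigenvector (Matrix.toLin' (G.adjMatrix ℝ)) (k : ℝ) 1 := by
    refine Module.End.hasEigenvector_iff.mpr ⟨Module.End.mem_eigenspace_iff.mpr ?_, one_ne_zero⟩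
    have := aeval_adjMatrix_mulVec_one hG X
    rw [aeval_X] at this
    rw [Matrix.toLin'_apply, this]
    ext
    simp
  have hmem := (Module.End.hasEigenvalue_of_hasEigenvector hvec).mem_spectrum
  rw [Matrix.spectrum_toLin', (adjMatrix_isHermitian G).spectrum_real_eq_range_eigenvalues] at hmem
  exact hmem

/-- If all eigenvalues but one are at most `l`, and `f` is nonpositive up to `l`, then `tr f(A)` is
at most `f(k)`. -/
theorem trace_aeval_le_eval_degree [Nonempty V] {k : ℕ} (hG : G.IsRegularOfDegree k) {l : ℝ}
    (hcard : 2 ≤ Fintype.card V) (h : secondEigenvalue G ≤ l) (hlk : l < k) {f : ℝ[X]}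
    (hf : ∀ x ≤ l, f.eval x ≤ 0) : (aeval (G.adjMatrix ℝ) f).trace ≤ f.eval (k : ℝ) := by
  obtain ⟨i, hi⟩ := exists_eigenvalues_eq_degree hG
  rw [trace_aeval_eq_sum_eigenvalues (adjMatrix_isHermitian G),
    ← Finset.sum_erase_add _ _ (Finset.mem_univ i), hi]
  refine add_le_of_nonpos_left (Finset.sum_nonpos fun j hj => hf _ ?_)
  by_contra! hlt
  exact Finset.ne_of_mem_erase hj (eigenvalues_gt_subsingleton hcard h hlt (by rwa [hi]))

/-- The linear programming bound for regular graphs: a `k`-regular graph whose second largest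
eigenvalue is at most the largest root `l` of `(c - 1) G_{n+1} + G_{n+2}` has at most
`((c - 1) G_{n+1}(k) + G_{n+2}(k)) / c` vertices. -/
theorem mul_card_le_of_secondEigenvalue_le {k : ℕ} (hk : 2 ≤ k) (hG : G.IsRegularOfDegree k)
    (hcard : 2 ≤ Fintype.card V) (n : ℕ) {c l : ℝ} (hc : 1 ≤ c)
    (hroot : (C (c - 1) * Gpoly k (n + 1) + Gpoly k (n + 2)).IsRoot l)
    (hmax : ∀ x : ℝ, (C (c - 1) * Gpoly k (n + 1) + Gpoly k (n + 2)).IsRoot x → x ≤ l)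
    (h : secondEigenvalue G ≤ l) :
    c * Fintype.card V ≤ (C (c - 1) * Gpoly k (n + 1) + Gpoly k (n + 2)).eval (k : ℝ) := by
  have : Nonempty V := Fintype.card_pos_iff.mp (by omega)
  have hk' : (2 : ℝ) ≤ k := by exact_mod_cast hk
  have hq : (0 : ℝ) < (k : ℝ) - 1 := by linarith
  set H : ℝ[X] := C (c - 1) * Gpoly k (n + 1) + Gpoly k (n + 2) with hH
  have hHpos : ∀ x, (k : ℝ) ≤ x → 0 < H.eval x := fun x hx => by
    rw [hH, eval_add, eval_mul, eval_C]
    exact add_pos_of_nonneg_of_pos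
      (mul_nonneg (sub_nonneg.mpr hc) (Gpoly_eval_pos hk hx _).le) (Gpoly_eval_pos hk hx _)
  have hlk : l < k := by
    by_contra! hle
    exact (hHpos l hle).ne' hroot
  have hGl : ∀ j ≤ n + 1, 0 < (Gpoly k j).eval l :=
    fun j hj => Gpoly_eval_pos_of_largest_root hk n hc hmax hj
  set w : ℕ → ℝ := fun i => ((k : ℝ) - 1) ^ (n + 1 - i) * (Gpoly k i).eval l with hw
  have hwpos : ∀ i ∈ Finset.range (n + 2), 0 < w i := fun i hi =>
    mul_pos (pow_pos hq _) (hGl i (Nat.lt_succ_iff.mp (Finset.mem_range.mp hi)))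
  set p : ℝ[X] := ∑ i ∈ Finset.range (n + 2), C (w i) * Gpoly k i with hp
  have hfactor : ∀ x, (x - l) * p.eval x = (Gpoly k (n + 1)).eval l * H.eval x := fun x => by
    have hl : (c - 1) * (Gpoly k (n + 1)).eval l + (Gpoly k (n + 2)).eval l = 0 := by
      have := hroot.eq_zero
      rwa [hH, eval_add, eval_mul, eval_C] at this
    have hcd := Gpoly_christoffel_darboux k (n + 1) x l
    have hpe : p.eval x = ∑ i ∈ Finset.range (n + 2),
        ((k : ℝ) - 1) ^ (n + 1 - i) * (Gpoly k i).eval l * (Gpoly k i).eval x := by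
      rw [hp, eval_finsetSum]
      exact Finset.sum_congr rfl fun i _ => by rw [eval_mul, eval_C]
    rw [hpe, ← hcd, hH, eval_add, eval_mul, eval_C]
    linear_combination -(Gpoly k (n + 1)).eval x * hl
  have hpk : 0 < p.eval (k : ℝ) := by
    have h₁ := hfactor k
    have h₂ := mul_pos (hGl (n + 1) le_rfl) (hHpos k le_rfl)
    rw [← h₁] at h₂
    exact pos_of_mul_pos_right h₂ (by linarith)
  have htrace := trace_aeval_le_eval_degree hG hcard h hlk (f := H * p) fun x hx => by
    have h₁ : (Gpoly k (n + 1)).eval l * (H * p).eval x = (x - l) * p.eval x ^ 2 := by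
      rw [eval_mul, ← mul_assoc, ← hfactor]
      ring
    have h₂ : (x - l) * p.eval x ^ 2 ≤ 0 :=
      mul_nonpos_of_nonpos_of_nonneg (by linarith) (sq_nonneg _)
    rw [← h₁] at h₂
    exact nonpos_of_mul_nonpos_right h₂ (hGl (n + 1) le_rfl)
  have happly : ∀ u v, aeval (G.adjMatrix ℝ) p u v
      = ∑ i ∈ Finset.range (n + 2), w i * aeval (G.adjMatrix ℝ) (Gpoly k i) u v := fun u v => by
    rw [hp, map_sum, Matrix.sum_apply]
    refine Finset.sum_congr rfl fun i _ => ?_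
    rw [map_mul, aeval_C, ← Algebra.smul_def, Matrix.smul_apply, smul_eq_mul]
  have hentry : ∀ u v, c * aeval (G.adjMatrix ℝ) p u v
      ≤ aeval (G.adjMatrix ℝ) H u v * aeval (G.adjMatrix ℝ) p u v := fun u v => by
    have hmono := aeval_Gpoly_mono hG u v
    have hpnonneg : 0 ≤ aeval (G.adjMatrix ℝ) p u v := by
      rw [happly]
      exact Finset.sum_nonneg fun i hi => mul_nonneg (hwpos i hi).le (aeval_Gpoly_nonneg hG i u v)
    have hHuv : aeval (G.adjMatrix ℝ) H u v = (c - 1) * aeval (G.adjMatrix ℝ) (Gpoly k (n + 1)) u v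
        + aeval (G.adjMatrix ℝ) (Gpoly k (n + 2)) u v := by
      rw [hH, map_add, Matrix.add_apply, map_mul, aeval_C, ← Algebra.smul_def, Matrix.smul_apply,
        smul_eq_mul]
    rcases aeval_Gpoly_eq_zero_or_one_le hG (n + 1) u v with h0 | h1
    · have : aeval (G.adjMatrix ℝ) p u v = 0 := by
        rw [happly]
        refine Finset.sum_eq_zero fun i hi => ?_
        have hle : aeval (G.adjMatrix ℝ) (Gpoly k i) u v ≤ 0 :=
          h0 ▸ hmono (Nat.lt_succ_iff.mp (Finset.mem_range.mp hi))
        rw [le_antisymm hle (aeval_Gpoly_nonneg hG i u v), mul_zero]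
      rw [this, mul_zero, mul_zero]
    · refine mul_le_mul_of_nonneg_right ?_ hpnonneg
      have h2 : 1 ≤ aeval (G.adjMatrix ℝ) (Gpoly k (n + 2)) u v :=
        h1.trans (hmono (Nat.le_succ _))
      rw [hHuv]
      nlinarith
  have hlower : c * Fintype.card V * p.eval (k : ℝ)
      ≤ (aeval (G.adjMatrix ℝ) (H * p)).trace := by
    calc c * Fintype.card V * p.eval (k : ℝ)
        = ∑ u, ∑ v, c * aeval (G.adjMatrix ℝ) p u v := by
          simp_rw [← Finset.mul_sum, sum_aeval_adjMatrix hG]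
          simp [mul_assoc]
      _ ≤ ∑ u, ∑ v, aeval (G.adjMatrix ℝ) H u v * aeval (G.adjMatrix ℝ) p u v :=
          Finset.sum_le_sum fun u _ => Finset.sum_le_sum fun v _ => hentry u v
      _ = (aeval (G.adjMatrix ℝ) (H * p)).trace := by
          rw [map_mul, Matrix.trace]
          refine Finset.sum_congr rfl fun u _ => ?_
          rw [Matrix.diag_apply, Matrix.mul_apply]
          refine Finset.sum_congr rfl fun v _ => ?_
          rw [(isSymm_aeval G.isSymm_adjMatrix p).apply]
  rw [eval_mul] at htrace
  exact le_of_mul_le_mul_right (hlower.trans htrace) hpk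

end Graph

theorem even_card_of_isRegularOfDegree_odd {V : Type*} [Fintype V] {G : SimpleGraph V}
    [DecidableRel G.Adj] {k : ℕ} (hG : G.IsRegularOfDegree k) (hk : Odd k) :
    Even (Fintype.card V) := by
  have h := G.sum_degrees_eq_twice_card_edges
  rw [Finset.sum_congr rfl fun v _ => hG v, Finset.sum_const, Finset.card_univ, smul_eq_mul] at h
  exact (Nat.even_mul.mp ⟨_, h.trans (two_mul _)⟩).resolve_right (Nat.not_even_iff_odd.mpr hk)

theorem two_le_card_of_isRegularOfDegree {V : Type*} [Fintype V] [Nonempty V]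
    {G : SimpleGraph V} [DecidableRel G.Adj] {k : ℕ} (hk : 1 ≤ k)
    (hG : G.IsRegularOfDegree k) : 2 ≤ Fintype.card V := by
  have h := G.degree_lt_card_verts (Classical.arbitrary V)
  rw [hG] at h
  omega

theorem Mbound_one_eq_eval_Gpoly (k n : ℕ) :
    Mbound k (n + 2) 1 = (Gpoly k (n + 1)).eval (k : ℝ) := by
  rw [Mbound, Gpoly, eval_finsetSum, Finset.sum_range_succ', Finset.sum_range_succ]
  simp only [Fpoly_eval_natCast, Nat.add_sub_cancel]
  simp only [Fpoly, eval_one]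
  ring

theorem exists_natCast_eval_Gpoly {k : ℕ} (hk : 1 ≤ k) (n : ℕ) :
    ∃ N : ℕ, (Gpoly k n).eval (k : ℝ) = N := by
  refine ⟨1 + ∑ i ∈ Finset.range n, k * (k - 1) ^ i, ?_⟩
  rw [Gpoly, eval_finsetSum, Finset.sum_range_succ']
  simp only [Fpoly_eval_natCast]
  push_cast [Nat.cast_sub hk]
  simp only [Fpoly, eval_one]
  ring

theorem stmt10 (k t : ℕ) (hk : 3 ≤ k) (ht : 2 ≤ t) (lam : ℝ)
    (hlam : (Gpoly k (t - 1)).IsRoot lam)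
    (hlammax : ∀ x : ℝ, (Gpoly k (t - 1)).IsRoot x → x ≤ lam)
    (hexists : ∃ (W : Type) (_ : Fintype W) (_ : DecidableEq W) (H : SimpleGraph W)
        (_ : DecidableRel H.Adj), H.Connected ∧ H.IsRegularOfDegree k ∧
        (Fintype.card W : ℝ) = Mbound k t 1 ∧ secondEigenvalue H ≤ lam)
    (c₁ lam1 : ℝ)
    (hlam1 : (C (c₁ - 1) * Gpoly k (t - 1) + Gpoly k t).IsRoot lam1)
    (hlam1max : ∀ x : ℝ, (C (c₁ - 1) * Gpoly k (t - 1) + Gpoly k t).IsRoot x → x ≤ lam1) :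
    ((k : ℝ) * ((k : ℝ) - 1) ^ (t - 1) < c₁ →
      ∀ (V : Type) [Fintype V] [DecidableEq V] (G : SimpleGraph V) [DecidableRel G.Adj],
        G.Connected → G.IsRegularOfDegree k → secondEigenvalue G ≤ lam1 →
        (Fintype.card V : ℝ) ≤ Mbound k t 1) ∧
    ((∃ m : ℕ, Mbound k t 1 = 2 * (m : ℝ)) → Odd k →
      (k : ℝ) * ((k : ℝ) - 1) ^ (t - 1) / 2 < c₁ →
      ∀ (V : Type) [Fintype V] [DecidableEq V] (G : SimpleGraph V) [DecidableRel G.Adj],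
        G.Connected → G.IsRegularOfDegree k → secondEigenvalue G ≤ lam1 →
        (Fintype.card V : ℝ) ≤ Mbound k t 1) := by
  obtain ⟨n, rfl⟩ : ∃ n, t = n + 2 := ⟨t - 2, by omega⟩
  rw [show n + 2 - 1 = n + 1 from rfl] at *
  have hk' : (3 : ℝ) ≤ k := by exact_mod_cast hk
  have hpow : (2 : ℝ) ≤ ((k : ℝ) - 1) ^ (n + 1) := by
    have := one_le_pow₀ (n := n) (show (1 : ℝ) ≤ (k : ℝ) - 1 by linarith)
    rw [pow_succ]
    nlinarith
  obtain ⟨N, hN⟩ := exists_natCast_eval_Gpoly (by omega : 1 ≤ k) (n + 1)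
  have key : 1 ≤ c₁ → ∀ (V : Type) [Fintype V] [DecidableEq V] (G : SimpleGraph V)
      [DecidableRel G.Adj], G.Connected → G.IsRegularOfDegree k → secondEigenvalue G ≤ lam1 →
      c₁ * Fintype.card V ≤ c₁ * N + k * ((k : ℝ) - 1) ^ (n + 1) := by
    intro hc V _ _ G _ hconn hreg hsec
    have := hconn.nonempty
    have h := mul_card_le_of_secondEigenvalue_le (by omega) hreg
      (two_le_card_of_isRegularOfDegree (by omega) hreg) n hc hlam1 hlam1max hsec
    rw [Gpoly_succ k (n + 1), eval_add, eval_add, eval_mul, eval_C, hN, Fpoly_eval_natCast] at h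
    linarith
  rw [Mbound_one_eq_eval_Gpoly, hN]
  refine ⟨fun hc V _ _ G _ hconn hreg hsec => ?_, ?_⟩
  · have h := key (by nlinarith) V G hconn hreg hsec
    have hlt : (Fintype.card V : ℝ) < N + 1 := by
      refine lt_of_mul_lt_mul_left (a := c₁) ?_ (by nlinarith)
      linarith
    have : Fintype.card V < N + 1 := by exact_mod_cast hlt
    exact_mod_cast Nat.lt_succ_iff.mp this
  · rintro ⟨m, hm⟩ hodd hc V _ _ G _ hconn hreg hsec
    have h := key (by nlinarith) V G hconn hreg hsec
    have hlt : (Fintype.card V : ℝ) < N + 2 := by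
      refine lt_of_mul_lt_mul_left (a := c₁) ?_ (by nlinarith)
      linarith
    have hlt' : Fintype.card V < N + 2 := by exact_mod_cast hlt
    have hN2 : N = 2 * m := by exact_mod_cast hm
    obtain ⟨r, hr⟩ := even_card_of_isRegularOfDegree_odd hreg hodd
    have : Fintype.card V ≤ N := by omega
    exact_mod_cast this
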